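/- Let y₁ be a solution of equation (2.1) on [t₀, τ₀). Assume a(t) > 0 for almost every t ∈ [t₀, τ₀), b²/a is locally integrable on [t₀, τ₀), and (a₁(t) − a(t))y₁(t)³ + (b₁(t) − b(t))y₁(t)² + (c₁(t) − c(t))y₁(t) + d₁(t) − d(t) ≥ 0 for all t ∈ [t₀, τ₀) (respectively, ≤ 0 for all t ∈ [t₀, τ₀)). Then every solution y of the Abel equation (1.1) on [t₀, τ₀) with y(t₀) ≥ y₁(t₀) (respectively, y(t₀) ≤ y₁(t₀)) satisfies y(t) ≥ y₁(t) (respectively, y(t) ≤ y₁(t)) for all t ∈ [t₀, τ₀); and if y(t₀) > y₁(t₀) (respectively, y(t₀) < y₁(t₀)), then y(t) > y₁(t) (respectively, y(t) < y₁(t)) for all t ∈ [t₀, τ₀). Moreover, every noncontinuable solution of (1.1) is defined on all of [t₀, τ₀). -/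

import Mathlib

open Set MeasureTheory intervalIntegral

/-- The right-hand side `-(a y³ + b y² + c y + d)` of the Abel equation (1.1). -/
noncomputable def abelRHS (a b c d y : ℝ → ℝ) (t : ℝ) : ℝ :=
  -(a t * y t ^ 3 + b t * y t ^ 2 + c t * y t + d t)

/-- `y` is a solution of the Abel equation `y' + a y³ + b y² + c y + d = 0` on the set `S`. -/
def IsAbelSolOn (a b c d y : ℝ → ℝ) (S : Set ℝ) : Prop :=
  ∀ t ∈ S, HasDerivWithinAt y (abelRHS a b c d y t) S t

/-- The set of real points of the interval `[t₀, τ)`, `τ` an extended real. -/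
def eIco (t₀ : ℝ) (τ : EReal) : Set ℝ := {t : ℝ | t₀ ≤ t ∧ (t : EReal) < τ}

/-- A solution `y` of the Abel equation on `[t₀, t₁) ⊆ [t₀, τ₀)` is noncontinuable if it
cannot be extended to the right as a solution on a larger subinterval of `[t₀, τ₀)`. -/
def Noncontinuable (a b c d : ℝ → ℝ) (t₀ : ℝ) (τ₀ t₁ : EReal) (y : ℝ → ℝ) : Prop :=
  ¬ ∃ (t₂ : EReal) (z : ℝ → ℝ), t₁ < t₂ ∧ t₂ ≤ τ₀ ∧
      IsAbelSolOn a b c d z (eIco t₀ t₂) ∧ EqOn z y (eIco t₀ t₁)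

theorem linear_comp {t₀ T : ℝ} (hT : t₀ ≤ T) (P w F : ℝ → ℝ) (hP : ContinuousOn P (Icc t₀ T))
    (hw : ∀ t ∈ Icc t₀ T, HasDerivWithinAt w (-P t * w t + F t) (Icc t₀ T) t)
    (hF : ∀ t ∈ Icc t₀ T, 0 ≤ F t) : ∃ k : ℝ, 0 < k ∧ k * w t₀ ≤ w T := by
  let P' : ℝ → ℝ := IccExtend hT ((Icc t₀ T).domRestrict P)
  have hP' : Continuous P' := (continuousOn_iff_continuous_domRestrict.1 hP).Icc_extend'
  have hPe : ∀ t ∈ Icc t₀ T, P' t = P t := fun t ht => by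
    simp only [P']; rw [IccExtend_of_mem _ _ ht]; rfl
  let Q : ℝ → ℝ := fun t => ∫ s in t₀..t, P' s
  have hQ : ∀ t, HasDerivAt Q (P' t) t := fun t =>
    integral_hasDerivAt_right (hP'.intervalIntegrable _ _)
      hP'.stronglyMeasurable.stronglyMeasurableAtFilter hP'.continuousAt
  have hder : ∀ t ∈ Icc t₀ T,
      HasDerivWithinAt (fun t => w t * Real.exp (Q t)) (F t * Real.exp (Q t)) (Icc t₀ T) t := by
    intro t ht
    have := (hw t ht).mul ((hQ t).exp.hasDerivWithinAt (s := Icc t₀ T))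
    refine this.congr_deriv ?_
    rw [hPe t ht]; ring
  have hmono : MonotoneOn (fun t => w t * Real.exp (Q t)) (Icc t₀ T) := by
    refine monotoneOn_of_hasDerivWithinAt_nonneg (f' := fun t => F t * Real.exp (Q t))
      (convex_Icc _ _) (fun t ht => (hder t ht).continuousWithinAt) ?_ ?_
    · intro x hx
      exact (hder x (interior_subset hx)).mono interior_subset
    · intro x hx
      exact mul_nonneg (hF x (interior_subset hx)) (Real.exp_pos _).le
  have h := hmono (left_mem_Icc.2 hT) (right_mem_Icc.2 hT) hT
  have h0 : Q t₀ = 0 := by simp [Q]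
  simp only [h0, Real.exp_zero, mul_one] at h
  refine ⟨Real.exp (-Q T), Real.exp_pos _, ?_⟩
  rw [Real.exp_neg, inv_mul_le_iff₀ (Real.exp_pos _)]
  linarith

theorem Icc_sub_eIco {t₀ T : ℝ} {τ : EReal} (h : (T : EReal) < τ) : Icc t₀ T ⊆ eIco t₀ τ :=
  fun _ ht => ⟨ht.1, lt_of_le_of_lt (EReal.coe_le_coe_iff.2 ht.2) h⟩

theorem abel_cont {a b c d y : ℝ → ℝ} {S : Set ℝ} (h : IsAbelSolOn a b c d y S) :
    ContinuousOn y S := fun t ht => (h t ht).continuousWithinAt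

/-- A priori bound. -/
theorem abel_bound {t₀ T N : ℝ} {a b c d : ℝ → ℝ}
    (ha : ContinuousOn a (Icc t₀ T)) (hb : ContinuousOn b (Icc t₀ T))
    (hc : ContinuousOn c (Icc t₀ T)) (hd : ContinuousOn d (Icc t₀ T))
    (hN : ∀ t ∈ Icc t₀ T, |c t| ≤ N ∧ |d t| ≤ N)
    (hapos : ∀ᵐ t ∂(volume.restrict (Icc t₀ T)), 0 < a t)
    (hint : IntegrableOn (fun s => b s ^ 2 / a s) (Icc t₀ T)) (x : ℝ) :
    ∃ M : ℝ, 0 ≤ M ∧ ∀ (s : ℝ) (y : ℝ → ℝ), t₀ ≤ s → s ≤ T → y t₀ = x →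
      IsAbelSolOn a b c d y (Icc t₀ s) → |y s| ≤ M := by
  let g : ℝ → ℝ := fun s => (b s ^ 2 / a s) / 2 + 3 * N
  have hg : IntegrableOn g (Icc t₀ T) :=
    (hint.div_const 2).add (continuousOn_const.integrableOn_Icc)
  refine ⟨Real.exp (Real.log (1 + x ^ 2) + ∫ s in t₀..T, g s), (Real.exp_pos _).le, ?_⟩
  intro s y h0 hs hyx hy
  have hsub : Icc t₀ s ⊆ Icc t₀ T := Icc_subset_Icc_right hs
  have hyc := abel_cont hy
  let V' : ℝ → ℝ := fun t => (2 * y t * abelRHS a b c d y t) / (1 + y t ^ 2)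
  have hpos : ∀ t, 0 < 1 + y t ^ 2 := fun t => by positivity
  have hV : ∀ t ∈ Icc t₀ s,
      HasDerivWithinAt (fun t => Real.log (1 + y t ^ 2)) (V' t) (Icc t₀ s) t := by
    intro t ht
    have := (((hy t ht).pow 2).const_add 1).log (hpos t).ne'
    refine this.congr_deriv ?_
    simp [V']
  have hV'c : ContinuousOn V' (Icc t₀ s) := by
    have ha' := ha.mono hsub
    have hb' := hb.mono hsub
    have hc' := hc.mono hsub
    have hd' := hd.mono hsub
    refine ContinuousOn.div ?_ (by fun_prop) (fun t _ => (hpos t).ne')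
    unfold abelRHS
    fun_prop
  have hV'i : IntervalIntegrable V' volume t₀ s := by
    apply ContinuousOn.intervalIntegrable
    rwa [uIcc_of_le h0]
  have hFTC := integral_eq_sub_of_hasDerivAt_of_le h0
    (fun t ht => (hV t ht).continuousWithinAt)
    (fun t ht => (hV t (Ioo_subset_Icc_self ht)).hasDerivAt (Icc_mem_nhds ht.1 ht.2)) hV'i
  have hgi : IntervalIntegrable g volume t₀ T :=
    (intervalIntegrable_iff_integrableOn_Icc_of_le (h0.trans hs)).2 hg
  have hgi' : IntervalIntegrable g volume t₀ s :=
    (intervalIntegrable_iff_integrableOn_Icc_of_le h0).2 (hg.mono_set hsub)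
  have hapos' : ∀ᵐ t ∂(volume.restrict (Icc t₀ s)), 0 < a t :=
    ae_mono (Measure.restrict_mono hsub le_rfl) hapos
  have hle : V' ≤ᵐ[volume.restrict (Icc t₀ s)] g := by
    filter_upwards [hapos', ae_restrict_mem measurableSet_Icc] with t hat ht
    obtain ⟨hcN, hdN⟩ := hN t (hsub ht)
    simp only [V', g, abelRHS]
    rw [div_le_iff₀ (hpos t)]
    generalize y t = u at *
    have h1 : 0 ≤ a t * u ^ 4 + b t * u ^ 3 + b t ^ 2 / a t / 4 * u ^ 2 := by
      have : a t * u ^ 4 + b t * u ^ 3 + b t ^ 2 / a t / 4 * u ^ 2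
          = u ^ 2 * (2 * a t * u + b t) ^ 2 / (4 * a t) := by
        field_simp; ring
      rw [this]; positivity
    have h2 : -(c t * u ^ 2) ≤ N * u ^ 2 := by
      nlinarith [sq_nonneg u, neg_abs_le (c t)]
    have h3 : -(2 * (d t * u)) ≤ N * (1 + u ^ 2) := by
      have hd1 := abs_le.1 hdN
      nlinarith [mul_nonneg (by linarith : 0 ≤ N - d t) (sq_nonneg (u - 1)),
        mul_nonneg (by linarith : 0 ≤ N + d t) (sq_nonneg (u + 1))]
    have h4 : 0 ≤ b t ^ 2 / a t := by positivity
    have h5 : 0 ≤ N := (abs_nonneg _).trans hcN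
    nlinarith
  have h1 := integral_mono_ae_restrict h0 hV'i hgi' hle
  have hN0 : t₀ ∈ Icc t₀ T := ⟨le_rfl, h0.trans hs⟩
  have hg0 : 0 ≤ᵐ[volume.restrict (Ioc t₀ T)] g := by
    refine ae_mono (Measure.restrict_mono Ioc_subset_Icc_self le_rfl) ?_
    filter_upwards [hapos] with t hat
    have h5 : 0 ≤ N := (abs_nonneg _).trans (hN t₀ hN0).1
    simp only [g, Pi.zero_apply]
    positivity
  have h2 := integral_mono_interval le_rfl h0 hs hg0 hgi
  have h3 : Real.log (1 + y s ^ 2) ≤ Real.log (1 + x ^ 2) + ∫ s in t₀..T, g s := by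
    rw [hFTC, hyx] at h1
    linarith
  have h4 := (Real.log_le_iff_le_exp (hpos s)).1 h3
  have h5 : |y s| ≤ 1 + y s ^ 2 := by
    rw [abs_le]; constructor <;> nlinarith [sq_nonneg (y s - 1), sq_nonneg (y s + 1)]
  exact h5.trans h4

/-- Clipping to `[-K, K]`. -/
noncomputable def clipK (K x : ℝ) : ℝ := max (-K) (min K x)

theorem clipK_abs {K : ℝ} (hK : 0 ≤ K) (x : ℝ) : |clipK K x| ≤ K :=
  abs_le.2 ⟨le_max_left _ _, max_le (by linarith) (min_le_left _ _)⟩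

theorem clipK_eq {K x : ℝ} (h : |x| ≤ K) : clipK K x = x := by
  have := abs_le.1 h
  simp [clipK, this.1, this.2]

theorem clipK_lip (K x y : ℝ) : |clipK K x - clipK K y| ≤ |x - y| := by
  unfold clipK
  refine (abs_max_sub_max_le_max _ _ _ _).trans ?_
  refine max_le (by simp) ((abs_min_sub_min_le_max _ _ _ _).trans ?_)
  simp

/-- Clipped vector field. -/
noncomputable def clipF (a b c d : ℝ → ℝ) (K t x : ℝ) : ℝ :=
  -(a t * clipK K x ^ 3 + b t * clipK K x ^ 2 + c t * clipK K x + d t)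

theorem clipF_bound {a b c d : ℝ → ℝ} {K N t x : ℝ} (hK : 0 ≤ K)
    (h : |a t| ≤ N ∧ |b t| ≤ N ∧ |c t| ≤ N ∧ |d t| ≤ N) :
    |clipF a b c d K t x| ≤ N * K ^ 3 + N * K ^ 2 + N * K + N := by
  obtain ⟨h1, h2, h3, h4⟩ := h
  have hp := clipK_abs hK x
  have hN : 0 ≤ N := (abs_nonneg _).trans h1
  unfold clipF
  rw [abs_neg]
  refine (abs_add_le _ _).trans (add_le_add ((abs_add_le _ _).trans (add_le_add
    ((abs_add_le _ _).trans (add_le_add ?_ ?_)) ?_)) h4)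
  · rw [abs_mul, abs_pow]; gcongr
  · rw [abs_mul, abs_pow]; gcongr
  · rw [abs_mul]; gcongr

theorem clipF_lip {a b c d : ℝ → ℝ} {K N t x y : ℝ} (hK : 0 ≤ K)
    (h : |a t| ≤ N ∧ |b t| ≤ N ∧ |c t| ≤ N ∧ |d t| ≤ N) :
    |clipF a b c d K t x - clipF a b c d K t y|
      ≤ (N * (K ^ 2 + K * K + K ^ 2) + N * (K + K) + N) * |x - y| := by
  obtain ⟨h1, h2, h3, h4⟩ := h
  have hp := clipK_abs hK x
  have hq := clipK_abs hK y
  have hl := clipK_lip K x y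
  have hN : 0 ≤ N := (abs_nonneg _).trans h1
  unfold clipF
  generalize clipK K x = p at *
  generalize clipK K y = q at *
  have e : -(a t * p ^ 3 + b t * p ^ 2 + c t * p + d t)
      - -(a t * q ^ 3 + b t * q ^ 2 + c t * q + d t)
      = -((a t * (p ^ 2 + p * q + q ^ 2) + b t * (p + q) + c t) * (p - q)) := by ring
  rw [e, abs_neg, abs_mul]
  have hb1 : |p ^ 2 + p * q + q ^ 2| ≤ K ^ 2 + K * K + K ^ 2 := by
    refine (abs_add_le _ _).trans (add_le_add ((abs_add_le _ _).trans (add_le_add ?_ ?_)) ?_)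
    · rw [abs_pow]; gcongr
    · rw [abs_mul]; gcongr
    · rw [abs_pow]; gcongr
  have hb2 : |p + q| ≤ K + K := (abs_add_le _ _).trans (add_le_add hp hq)
  refine mul_le_mul ?_ hl (abs_nonneg _) (by positivity)
  refine (abs_add_le _ _).trans (add_le_add ((abs_add_le _ _).trans (add_le_add ?_ ?_)) h3)
  · rw [abs_mul]; gcongr
  · rw [abs_mul]; gcongr

theorem abel_extend {t₀ t₁ T : ℝ} (h01 : t₀ < t₁) (h1T : t₁ < T) {a b c d y : ℝ → ℝ}
    (ha : ContinuousOn a (Icc t₀ T)) (hb : ContinuousOn b (Icc t₀ T))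
    (hc : ContinuousOn c (Icc t₀ T)) (hd : ContinuousOn d (Icc t₀ T))
    (hapos : ∀ᵐ t ∂(volume.restrict (Icc t₀ T)), 0 < a t)
    (hint : IntegrableOn (fun s => b s ^ 2 / a s) (Icc t₀ T))
    (hy : IsAbelSolOn a b c d y (Ico t₀ t₁)) :
    ∃ (t₂ : ℝ) (z : ℝ → ℝ), t₁ < t₂ ∧ t₂ ≤ T ∧ IsAbelSolOn a b c d z (Ico t₀ t₂) ∧
      EqOn z y (Ico t₀ t₁) := by
  obtain ⟨Na, hNa⟩ := isCompact_Icc.exists_bound_of_continuousOn ha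
  obtain ⟨Nb, hNb⟩ := isCompact_Icc.exists_bound_of_continuousOn hb
  obtain ⟨Nc, hNc⟩ := isCompact_Icc.exists_bound_of_continuousOn hc
  obtain ⟨Nd, hNd⟩ := isCompact_Icc.exists_bound_of_continuousOn hd
  obtain ⟨N, hN⟩ : ∃ N : ℝ, ∀ t ∈ Icc t₀ T, |a t| ≤ N ∧ |b t| ≤ N ∧ |c t| ≤ N ∧ |d t| ≤ N := by
    refine ⟨max (max Na Nb) (max Nc Nd), fun t ht => ⟨?_, ?_, ?_, ?_⟩⟩
    · exact (hNa t ht).trans (by simp)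
    · exact (hNb t ht).trans (by simp)
    · exact (hNc t ht).trans (by simp)
    · exact (hNd t ht).trans (by simp)
  obtain ⟨M, hM0, hM⟩ := abel_bound ha hb hc hd (fun t ht => (hN t ht).2.2) hapos hint (y t₀)
  have h0T : t₀ ≤ T := (h01.trans h1T).le
  have hN0 : 0 ≤ N := (abs_nonneg _).trans (hN t₀ ⟨le_rfl, h0T⟩).1
  set K : ℝ := M + 1 with hKdef
  have hK : 0 ≤ K := by positivity
  have hyM : ∀ s ∈ Ico t₀ t₁, |y s| ≤ M := by
    intro s hs
    refine hM s y hs.1 (hs.2.trans h1T).le rfl ?_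
    have hsub : Icc t₀ s ⊆ Ico t₀ t₁ := fun u hu => ⟨hu.1, hu.2.trans_lt hs.2⟩
    exact fun t ht => (hy t (hsub ht)).mono hsub
  -- Picard–Lindelöf
  obtain ⟨L, hL⟩ : ∃ L : NNReal, (L : ℝ) = N * K ^ 3 + N * K ^ 2 + N * K + N :=
    ⟨⟨_, by positivity⟩, rfl⟩
  obtain ⟨Λ, hΛ⟩ : ∃ Λ : NNReal, (Λ : ℝ) = N * (K ^ 2 + K * K + K ^ 2) + N * (K + K) + N :=
    ⟨⟨_, by positivity⟩, rfl⟩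
  have hlip : ∀ t ∈ Icc t₀ T, ∀ s : Set ℝ, LipschitzOnWith Λ (clipF a b c d K t) s := by
    intro t ht s
    refine LipschitzOnWith.of_dist_le_mul fun x _ x' _ => ?_
    rw [Real.dist_eq, Real.dist_eq, hΛ]
    exact clipF_lip hK (hN t ht)
  have hPL : IsPicardLindelof (clipF a b c d K) (tmin := t₀) (tmax := T)
      ⟨t₀, left_mem_Icc.2 h0T⟩ (y t₀) (L * (T - t₀).toNNReal) 0 L Λ := by
    refine ⟨fun t ht => hlip t ht _, ?_, ?_, ?_⟩
    · intro x _
      unfold clipF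
      fun_prop
    · intro t ht x _
      rw [Real.norm_eq_abs, hL]
      exact clipF_bound hK (hN t ht)
    · have : 0 ≤ T - t₀ := by linarith
      simp [this]
  obtain ⟨z, hz0, hz⟩ := hPL.exists_eq_forall_mem_Icc_hasDerivWithinAt₀
  have hzc : ContinuousOn z (Icc t₀ T) := fun t ht => (hz t ht).continuousWithinAt
  have hzy : EqOn z y (Ico t₀ t₁) := by
    intro s hs
    have hsT : s < T := hs.2.trans h1T
    have hsub : Icc t₀ s ⊆ Ico t₀ t₁ := fun u hu => ⟨hu.1, hu.2.trans_lt hs.2⟩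
    refine ODE_solution_unique_of_mem_Icc_right (v := clipF a b c d K) (s := fun _ => univ)
      (K := Λ) (a := t₀) (b := s) ?_ ?_ ?_ (fun _ _ => mem_univ _) ?_ ?_
      (fun _ _ => mem_univ _) hz0 (right_mem_Icc.2 hs.1)
    · exact fun t ht => hlip t ⟨ht.1, (ht.2.trans hsT).le⟩ _
    · exact hzc.mono (Icc_subset_Icc_right hsT.le)
    · intro t ht
      refine (hz t ⟨ht.1, (ht.2.trans hsT).le⟩).mono_of_mem_nhdsWithin ?_
      exact Filter.mem_of_superset (Icc_mem_nhdsGE (ht.2.trans hsT))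
        (Icc_subset_Icc_left ht.1)
    · exact (abel_cont hy).mono hsub
    · intro t ht
      have ht1 : t ∈ Ico t₀ t₁ := ⟨ht.1, ht.2.trans hs.2⟩
      have h := (hy t ht1).mono_of_mem_nhdsWithin (s := Ici t)
        (Filter.mem_of_superset (Ico_mem_nhdsGE ht1.2) (Ico_subset_Ico_left ht.1))
      refine h.congr_deriv ?_
      unfold clipF abelRHS
      rw [clipK_eq]
      exact (hyM t ht1).trans (by linarith)
  have hzt1 : ContinuousAt z t₁ := hzc.continuousAt (Icc_mem_nhds h01 h1T)
  have hz1 : |z t₁| ≤ M := by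
    have ht : Filter.Tendsto (fun t => |z t|) (nhdsWithin t₁ (Iio t₁)) (nhds |z t₁|) :=
      (hzt1.abs.tendsto).mono_left nhdsWithin_le_nhds
    refine le_of_tendsto ht ?_
    filter_upwards [Ioo_mem_nhdsLT h01] with t ht
    rw [hzy ⟨ht.1.le, ht.2⟩]
    exact hyM t ⟨ht.1.le, ht.2⟩
  have hev : ∀ᶠ t in nhds t₁, |z t| < K :=
    hzt1.abs.eventually_lt continuousAt_const (by linarith)
  obtain ⟨ε, hε, hball⟩ := Metric.eventually_nhds_iff.1 hev
  have hzsol : ∀ t ∈ Ico t₀ (min (t₁ + ε) T), |z t| ≤ K := by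
    intro t ht
    rcases lt_or_ge t t₁ with h | h
    · rw [hzy ⟨ht.1, h⟩]
      exact (hyM t ⟨ht.1, h⟩).trans (by linarith)
    · refine (hball ?_).le
      have := lt_min_iff.1 ht.2
      rw [Real.dist_eq, abs_lt]
      constructor <;> linarith
  refine ⟨min (t₁ + ε) T, z, lt_min (by linarith) h1T, min_le_right _ _, ?_, hzy⟩
  have hsub : Ico t₀ (min (t₁ + ε) T) ⊆ Icc t₀ T :=
    fun t ht => ⟨ht.1, (lt_min_iff.1 ht.2).2.le⟩
  intro t ht
  refine ((hz t (hsub ht)).mono hsub).congr_deriv ?_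
  unfold clipF abelRHS
  rw [clipK_eq (hzsol t ht)]

theorem eIco_coe (t₀ s : ℝ) : eIco t₀ (s : EReal) = Ico t₀ s := by
  ext t; simp [eIco]

theorem abel_comp {t₀ T : ℝ} (hT : t₀ ≤ T) {a b c d a₁ b₁ c₁ d₁ y y₁ : ℝ → ℝ}
    (ha : ContinuousOn a (Icc t₀ T)) (hb : ContinuousOn b (Icc t₀ T))
    (hc : ContinuousOn c (Icc t₀ T))
    (hy : IsAbelSolOn a b c d y (Icc t₀ T)) (hy₁ : IsAbelSolOn a₁ b₁ c₁ d₁ y₁ (Icc t₀ T))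
    (σ : ℝ)
    (h : ∀ t ∈ Icc t₀ T, 0 ≤ σ * ((a₁ t - a t) * y₁ t ^ 3 + (b₁ t - b t) * y₁ t ^ 2 +
          (c₁ t - c t) * y₁ t + (d₁ t - d t))) :
    ∃ k : ℝ, 0 < k ∧ k * (σ * (y t₀ - y₁ t₀)) ≤ σ * (y T - y₁ T) := by
  have hyc := abel_cont hy
  have hyc₁ := abel_cont hy₁
  refine linear_comp hT
    (fun t => a t * (y t ^ 2 + y t * y₁ t + y₁ t ^ 2) + b t * (y t + y₁ t) + c t)
    (fun t => σ * (y t - y₁ t)) _ (by fun_prop) ?_ h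
  intro t ht
  refine (((hy t ht).sub (hy₁ t ht)).const_mul σ).congr_deriv ?_
  unfold abelRHS
  ring

/-- Theorem 3.4 (in the form of STATEMENT 7): with `a > 0` a.e. and `b²/a` locally
integrable, a sign condition on the comparison expression yields one-sided comparison with
a solution `y₁` of (2.1) (with the respective dual version), and moreover every
noncontinuable solution of (1.1) is defined on all of `[t₀, τ₀)`. -/
theorem stmt_7 (t₀ : ℝ) (τ₀ : EReal) (hτ : (t₀ : EReal) < τ₀)
    (a b c d a₁ b₁ c₁ d₁ y₁ : ℝ → ℝ)
    (ha : ContinuousOn a (eIco t₀ τ₀)) (hb : ContinuousOn b (eIco t₀ τ₀))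
    (hc : ContinuousOn c (eIco t₀ τ₀)) (hd : ContinuousOn d (eIco t₀ τ₀))
    (ha₁ : ContinuousOn a₁ (eIco t₀ τ₀)) (hb₁ : ContinuousOn b₁ (eIco t₀ τ₀))
    (hc₁ : ContinuousOn c₁ (eIco t₀ τ₀)) (hd₁ : ContinuousOn d₁ (eIco t₀ τ₀))
    (hy₁ : IsAbelSolOn a₁ b₁ c₁ d₁ y₁ (eIco t₀ τ₀))
    (hapos : ∀ᵐ t ∂(volume.restrict (eIco t₀ τ₀)), 0 < a t)
    (hint : ∀ t : ℝ, t₀ < t → (t : EReal) < τ₀ →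
      IntegrableOn (fun s => b s ^ 2 / a s) (Icc t₀ t)) :
    ((∀ t ∈ eIco t₀ τ₀, 0 ≤ (a₁ t - a t) * y₁ t ^ 3 + (b₁ t - b t) * y₁ t ^ 2 +
          (c₁ t - c t) * y₁ t + (d₁ t - d t)) →
      ∀ y : ℝ → ℝ, IsAbelSolOn a b c d y (eIco t₀ τ₀) → y₁ t₀ ≤ y t₀ →
        (∀ t ∈ eIco t₀ τ₀, y₁ t ≤ y t) ∧
          (y₁ t₀ < y t₀ → ∀ t ∈ eIco t₀ τ₀, y₁ t < y t)) ∧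
    ((∀ t ∈ eIco t₀ τ₀, (a₁ t - a t) * y₁ t ^ 3 + (b₁ t - b t) * y₁ t ^ 2 +
          (c₁ t - c t) * y₁ t + (d₁ t - d t) ≤ 0) →
      ∀ y : ℝ → ℝ, IsAbelSolOn a b c d y (eIco t₀ τ₀) → y t₀ ≤ y₁ t₀ →
        (∀ t ∈ eIco t₀ τ₀, y t ≤ y₁ t) ∧
          (y t₀ < y₁ t₀ → ∀ t ∈ eIco t₀ τ₀, y t < y₁ t)) ∧
    (∀ (t₁ : EReal) (y : ℝ → ℝ), (t₀ : EReal) < t₁ → t₁ ≤ τ₀ →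
      IsAbelSolOn a b c d y (eIco t₀ t₁) →
      Noncontinuable a b c d t₀ τ₀ t₁ y → t₁ = τ₀) := by
  have hmono : ∀ {y A B C D}, IsAbelSolOn A B C D y (eIco t₀ τ₀) → ∀ t ∈ eIco t₀ τ₀,
      IsAbelSolOn A B C D y (Icc t₀ t) := fun h t ht s hs =>
    (h s (Icc_sub_eIco ht.2 hs)).mono (Icc_sub_eIco ht.2)
  refine ⟨fun h y hy h0 => ?_, fun h y hy h0 => ?_, ?_⟩
  · have key : ∀ t ∈ eIco t₀ τ₀, ∃ k : ℝ, 0 < k ∧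
        k * (1 * (y t₀ - y₁ t₀)) ≤ 1 * (y t - y₁ t) := fun t ht =>
      abel_comp ht.1 (ha.mono (Icc_sub_eIco ht.2)) (hb.mono (Icc_sub_eIco ht.2))
        (hc.mono (Icc_sub_eIco ht.2)) (hmono hy t ht) (hmono hy₁ t ht) 1
        (fun s hs => by simpa using h s (Icc_sub_eIco ht.2 hs))
    refine ⟨fun t ht => ?_, fun h1 t ht => ?_⟩
    · obtain ⟨k, hk, hk'⟩ := key t ht
      have := mul_nonneg hk.le (sub_nonneg.2 h0)
      linarith
    · obtain ⟨k, hk, hk'⟩ := key t ht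
      have := mul_pos hk (sub_pos.2 h1)
      linarith
  · have key : ∀ t ∈ eIco t₀ τ₀, ∃ k : ℝ, 0 < k ∧
        k * ((-1) * (y t₀ - y₁ t₀)) ≤ (-1) * (y t - y₁ t) := fun t ht =>
      abel_comp ht.1 (ha.mono (Icc_sub_eIco ht.2)) (hb.mono (Icc_sub_eIco ht.2))
        (hc.mono (Icc_sub_eIco ht.2)) (hmono hy t ht) (hmono hy₁ t ht) (-1)
        (fun s hs => by linarith [h s (Icc_sub_eIco ht.2 hs)])
    refine ⟨fun t ht => ?_, fun h1 t ht => ?_⟩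
    · obtain ⟨k, hk, hk'⟩ := key t ht
      have := mul_nonneg hk.le (sub_nonneg.2 h0)
      linarith
    · obtain ⟨k, hk, hk'⟩ := key t ht
      have := mul_pos hk (sub_pos.2 h1)
      linarith
  · intro t₁ y h01 h1τ hy hnc
    by_contra hne
    have hlt : t₁ < τ₀ := lt_of_le_of_ne h1τ hne
    lift t₁ to ℝ using ⟨hlt.ne_top, (lt_of_le_of_lt bot_le h01).ne'⟩
    obtain ⟨T, hT1, hT2⟩ := EReal.lt_iff_exists_real_btwn.1 hlt
    have h01' := EReal.coe_lt_coe_iff.1 h01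
    have h1T := EReal.coe_lt_coe_iff.1 hT1
    have hsub : Icc t₀ T ⊆ eIco t₀ τ₀ := Icc_sub_eIco hT2
    rw [eIco_coe] at hy
    obtain ⟨t₂, z, h12, h2T, hz, hzy⟩ := abel_extend h01' h1T (ha.mono hsub) (hb.mono hsub)
      (hc.mono hsub) (hd.mono hsub) (ae_mono (Measure.restrict_mono hsub le_rfl) hapos)
      (hint T (h01'.trans h1T) hT2) hy
    refine hnc ⟨t₂, z, EReal.coe_lt_coe_iff.2 h12,
      (EReal.coe_le_coe_iff.2 h2T).trans hT2.le, ?_, ?_⟩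
    · rwa [eIco_coe]
    · rwa [eIco_coe]
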